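/- Let F₁ and F₂ be cumulative distribution functions on ℝ, both continuous and strictly increasing, with F₁(x) < 1 and F₂(x) < 1 for all x. Suppose: (i) F₂ has a heavier right tail than F₁, i.e., for every μ ∈ ℝ and σ > 0, (1 − F₂(x))/(1 − F₁((x − μ)/σ)) → +∞ as x → +∞; (ii) F₂ admits a density p₂ that is decreasing for all sufficiently large x; (iii) the ratio F₂⁻¹(α)/F₁⁻¹(α) is non-decreasing in α for α sufficiently close to 1. Then for every μ ∈ ℝ and σ > 0 there exist functions g₁, g₂ : ℝ → ℝ satisfying conditions (C1)–(C4) such that, with f(x) = μ + σ·x·(g₁(x) + g₂(x) + 1), one has (1 − F₂(x))/(1 − F₁(f⁻¹(x))) → 1 as x → +∞; in particular, the distribution F₁ ∘ f⁻¹ has the same right-tail heaviness as F₂. (Proposition 6) -/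

import Mathlib

open Filter Real Set

open intervalIntegral in
/-- The unit-step moving average of an antitone function is continuous, antitone, and lies between
two values of the function. -/
theorem Antitone.movingAverage {u : ℝ → ℝ} (hu : Antitone u) :
    Continuous (fun y => ∫ t in y..y + 1, u t) ∧ Antitone (fun y => ∫ t in y..y + 1, u t) ∧
      ∀ y, u (y + 1) ≤ ∫ t in y..y + 1, u t ∧ ∫ t in y..y + 1, u t ≤ u y := by
  have hint : ∀ a b, IntervalIntegrable u MeasureTheory.volume a b :=
    fun a b => hu.intervalIntegrable
  refine ⟨?_, ?_, fun y => ⟨?_, ?_⟩⟩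
  · have heq : (fun y => ∫ t in y..y + 1, u t)
        = fun y => (∫ t in (0 : ℝ)..y + 1, u t) - ∫ t in (0 : ℝ)..y, u t := by
      funext y
      rw [integral_interval_sub_left (hint _ _) (hint _ _)]
    rw [heq]
    have hc := continuous_primitive hint 0
    exact (hc.comp (continuous_id.add continuous_const)).sub hc
  · have heq : ∀ y, ∫ t in y..y + 1, u t = ∫ s in (0 : ℝ)..1, u (s + y) := by
      intro y
      rw [integral_comp_add_right]
      simp [add_comm]
    have hshift : ∀ y, Antitone fun s => u (s + y) := fun y s t hst => hu (by linarith)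
    intro y z hyz
    simp only [heq]
    exact integral_mono_on zero_le_one (hshift z).intervalIntegrable
      (hshift y).intervalIntegrable (fun s _ => hu (by linarith))
  · have := integral_mono_on (a := y) (b := y + 1) (f := fun _ => u (y + 1)) (g := u)
      (μ := MeasureTheory.volume) (by linarith) (by simp) (hint _ _) (fun t ht => hu ht.2)
    simpa using this
  · have := integral_mono_on (a := y) (b := y + 1) (g := fun _ => u y) (f := u)
      (μ := MeasureTheory.volume) (by linarith) (hint _ _) (by simp) (fun t ht => hu ht.1)
    simpa using this

/-- A positive antitone function bounded by one dominates a positive differentiable function `δ`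
for which `y ↦ y + δ y` is monotone. -/
theorem Antitone.exists_differentiable_pos_le {u : ℝ → ℝ} (hu : Antitone u)
    (hpos : ∀ y, 0 < u y) (hle : ∀ y, u y ≤ 1) :
    ∃ δ : ℝ → ℝ, Differentiable ℝ δ ∧ (∀ y, 0 < δ y) ∧ (∀ y, δ y ≤ u y) ∧
      Monotone fun y => y + δ y := by
  obtain ⟨hvc, hva, hvb⟩ := hu.movingAverage
  set v : ℝ → ℝ := fun y => ∫ t in y..y + 1, u t
  obtain ⟨-, -, hwb⟩ := hva.movingAverage
  have hderiv : ∀ y, HasDerivAt (fun y => ∫ t in y..y + 1, v t) (v (y + 1) - v y) y := by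
    intro y
    have heq : (fun y => ∫ t in y..y + 1, v t)
        = fun y => (∫ t in (0 : ℝ)..y + 1, v t) - ∫ t in (0 : ℝ)..y, v t := by
      funext y
      rw [intervalIntegral.integral_interval_sub_left] <;> exact hva.intervalIntegrable
    rw [heq]
    have hd : ∀ z, HasDerivAt (fun z => ∫ t in (0 : ℝ)..z, v t) (v z) z :=
      fun z => (hvc.integral_hasStrictDerivAt 0 z).hasDerivAt
    exact ((hd (y + 1)).comp_add_const y 1).sub (hd y)
  refine ⟨fun y => ∫ t in y..y + 1, v t, fun y => (hderiv y).differentiableAt,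
    fun y => ?_, fun y => (hwb y).2.trans (hvb y).2, ?_⟩
  · exact (hpos _).trans_le ((hvb _).1.trans (hwb y).1)
  · refine monotone_of_deriv_nonneg
      (fun y => ((hasDerivAt_id y).add (hderiv y)).differentiableAt) fun y => ?_
    have h := ((hasDerivAt_id y).add (hderiv y)).deriv
    have hv0 : 0 < v (y + 1) := (hpos _).trans_le (hvb _).1
    have hv1 : v y ≤ 1 := (hvb _).2.trans (hle _)
    change 0 ≤ deriv (id + fun y => ∫ t in y..y + 1, v t) y
    rw [h]
    linarith

/-- A positive antitone modulus of relative continuity for the tail `1 - F`. -/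
theorem exists_antitone_tail_modulus {F : ℝ → ℝ} (hcont : Continuous F) (hmono : StrictMono F)
    (hlt : ∀ x, F x < 1) :
    ∃ u : ℝ → ℝ, Antitone u ∧ (∀ y, 0 < u y) ∧ (∀ y, u y ≤ 1) ∧
      ∀ y, 0 ≤ y → F (y + u y) - F y ≤ exp (-y) * (1 - F y) := by
  set E : ℝ → Set ℝ := fun y =>
    {d | d ≤ 1 ∧ ∀ t ∈ Icc 0 y, F (t + d) - F t ≤ exp (-y) * (1 - F y)}
  have hbdd : ∀ y, BddAbove (E y) := fun y => ⟨1, fun d hd => hd.1⟩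
  have hE : ∀ y, ∃ d ∈ E y, 0 < d := by
    intro y
    have huc := Metric.uniformContinuousOn_iff.1
      ((isCompact_Icc (a := (0 : ℝ)) (b := y + 1)).uniformContinuousOn_of_continuous
        hcont.continuousOn)
    obtain ⟨e, he, h⟩ := huc (exp (-y) * (1 - F y))
      (mul_pos (exp_pos _) (sub_pos.2 (hlt y)))
    have hd0 : 0 < min 1 (e / 2) := by positivity
    refine ⟨min 1 (e / 2), ⟨min_le_left _ _, fun t ht => ?_⟩, hd0⟩
    have hd1 : min 1 (e / 2) ≤ 1 := min_le_left _ _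
    have hde : min 1 (e / 2) ≤ e / 2 := min_le_right _ _
    have := h (t + min 1 (e / 2)) ⟨by linarith [ht.1], by linarith [ht.2]⟩ t
      ⟨ht.1, by linarith [ht.2]⟩ (by rw [Real.dist_eq, add_sub_cancel_left, abs_of_pos hd0]; linarith)
    rw [Real.dist_eq] at this
    exact (le_abs_self _).trans this.le
  have hsup : ∀ y, 0 < sSup (E y) := fun y => by
    obtain ⟨d, hd, hd0⟩ := hE y
    exact hd0.trans_le (le_csSup (hbdd y) hd)
  refine ⟨fun y => sSup (E y) / 2, ?_, fun y => half_pos (hsup y), fun y => ?_, fun y hy => ?_⟩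
  · intro y z hyz
    have hsub : E z ⊆ E y := by
      intro d hd
      refine ⟨hd.1, fun t ht => (hd.2 t ⟨ht.1, ht.2.trans hyz⟩).trans ?_⟩
      have h1 : 1 - F z ≤ 1 - F y := by linarith [hmono.monotone hyz]
      have h2 : 0 ≤ 1 - F z := by linarith [hlt z]
      gcongr
    obtain ⟨d, hd, -⟩ := hE z
    have := csSup_le_csSup (hbdd y) ⟨d, hd⟩ hsub
    change sSup (E z) / 2 ≤ sSup (E y) / 2
    linarith
  · obtain ⟨d, hd, -⟩ := hE y
    have : sSup (E y) ≤ 1 := csSup_le ⟨d, hd⟩ fun d hd => hd.1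
    linarith
  · obtain ⟨d, hd, -⟩ := hE y
    obtain ⟨e, he, hlt'⟩ := exists_lt_of_lt_csSup ⟨d, hd⟩ (half_lt_self (hsup y))
    have := hmono.monotone (show y + sSup (E y) / 2 ≤ y + e by linarith)
    have := he.2 y ⟨hy, le_rfl⟩
    linarith

/-- Averaging a continuous monotone function `q` over `[y, y + δ y]` gives a differentiable
monotone function. -/
theorem Monotone.exists_differentiable_between {q δ : ℝ → ℝ} (hq : Monotone q)
    (hqc : Continuous q) (hδ : Differentiable ℝ δ) (hpos : ∀ y, 0 < δ y)
    (hδm : Monotone fun y => y + δ y) :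
    ∃ r : ℝ → ℝ, Differentiable ℝ r ∧ Monotone r ∧ ∀ y, q y ≤ r y ∧ r y ≤ q (y + δ y) := by
  have heq : ∀ y, (∫ t in y..y + δ y, q t) / δ y = ∫ s in (0 : ℝ)..1, q (y + δ y * s) := by
    intro y
    have := intervalIntegral.smul_integral_comp_add_mul (a := 0) (b := 1) q (δ y) y
    rw [smul_eq_mul, mul_zero, mul_one, add_zero] at this
    rw [← this, mul_div_cancel_left₀ _ (hpos y).ne']
  have hint : ∀ y, IntervalIntegrable (fun s => q (y + δ y * s)) MeasureTheory.volume 0 1 :=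
    fun y => Continuous.intervalIntegrable (by fun_prop) _ _
  refine ⟨fun y => (∫ t in y..y + δ y, q t) / δ y, ?_, ?_, fun y => ⟨?_, ?_⟩⟩
  · have hd : Differentiable ℝ fun z => ∫ t in (0 : ℝ)..z, q t :=
      fun z => (hqc.integral_hasStrictDerivAt 0 z).hasDerivAt.differentiableAt
    have hsub : (fun y => ∫ t in y..y + δ y, q t)
        = fun y => (∫ t in (0 : ℝ)..y + δ y, q t) - ∫ t in (0 : ℝ)..y, q t := by
      funext y
      rw [intervalIntegral.integral_interval_sub_left] <;> exact hq.intervalIntegrable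
    have hnum : Differentiable ℝ fun y => ∫ t in y..y + δ y, q t := by
      rw [hsub]
      exact (hd.comp (differentiable_id.add hδ)).sub hd
    exact hnum.div hδ fun y => (hpos y).ne'
  · intro y z hyz
    simp only [heq]
    refine intervalIntegral.integral_mono_on zero_le_one (hint y) (hint z) fun s hs => hq ?_
    have : y + δ y ≤ z + δ z := hδm hyz
    nlinarith [hs.1, hs.2]
  · simp only [heq]
    have := intervalIntegral.integral_mono_on (a := 0) (b := 1) (f := fun _ => q y)
      zero_le_one (by simp) (hint y) fun s hs => hq (by nlinarith [hs.1, hpos y])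
    simpa using this
  · simp only [heq]
    have := intervalIntegral.integral_mono_on (a := 0) (b := 1) (g := fun _ => q (y + δ y))
      zero_le_one (hint y) (by simp) fun s hs => hq (by nlinarith [hs.2, hpos y])
    simpa using this

/-- A bounded antitone function, equal to `x⁻¹` on `[1, ∞)`. -/
noncomputable def cappedInv (x : ℝ) : ℝ := (max x 1)⁻¹ + (1 - min (max x 0) 1)

theorem cappedInv_of_nonpos {x : ℝ} (hx : x ≤ 0) : cappedInv x = 2 := by
  rw [cappedInv, max_eq_right (by linarith), max_eq_right hx, min_eq_left zero_le_one]
  norm_num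

theorem cappedInv_of_mem_Icc {x : ℝ} (hx : x ∈ Icc (0 : ℝ) 1) : cappedInv x = 2 - x := by
  rw [cappedInv, max_eq_right hx.2, max_eq_left hx.1, min_eq_left hx.2]
  ring

theorem cappedInv_of_one_le {x : ℝ} (hx : 1 ≤ x) : cappedInv x = x⁻¹ := by
  rw [cappedInv, max_eq_left hx, max_eq_left (by linarith), min_eq_right hx]
  ring

theorem continuous_cappedInv : Continuous cappedInv := by
  unfold cappedInv
  refine Continuous.add (Continuous.inv₀ (by fun_prop) fun x => ?_) (by fun_prop)
  exact (zero_lt_one.trans_le (le_max_right x 1)).ne'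

theorem antitone_cappedInv : Antitone cappedInv := by
  intro x y hxy
  unfold cappedInv
  gcongr

theorem cappedInv_nonneg (x : ℝ) : 0 ≤ cappedInv x := by
  unfold cappedInv
  have h1 : 0 ≤ (max x 1)⁻¹ := inv_nonneg.2 (zero_le_one.trans (le_max_right x 1))
  linarith [min_le_right (max x 0) 1]

theorem cappedInv_le_two (x : ℝ) : cappedInv x ≤ 2 := by
  rcases le_total x 0 with hx | hx
  · exact (cappedInv_of_nonpos hx).le
  · exact (antitone_cappedInv hx).trans (cappedInv_of_nonpos le_rfl).le

/-- Away from the origin `x * cappedInv x` has a nonnegative derivative. -/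
theorem exists_hasDerivAt_cappedInv {x : ℝ} (hx : x ≠ 0) :
    ∃ d, HasDerivAt cappedInv d x ∧ 0 ≤ cappedInv x + x * d := by
  have hinv : ∀ y : ℝ, 0 < y → HasDerivAt (fun z : ℝ => z⁻¹) (-(y ^ 2)⁻¹) y :=
    fun y hy => hasDerivAt_inv hy.ne'
  have hlin : ∀ y : ℝ, HasDerivAt (fun z : ℝ => 2 - z) (-1) y :=
    fun y => (hasDerivAt_id y).const_sub 2
  rcases hx.lt_or_gt with hx | hx
  · refine ⟨0, (hasDerivAt_const x (2 : ℝ)).congr_of_eventuallyEq ?_, ?_⟩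
    · filter_upwards [Iio_mem_nhds hx] with y hy using cappedInv_of_nonpos (le_of_lt hy)
    · rw [cappedInv_of_nonpos hx.le]
      norm_num
  rcases lt_trichotomy x 1 with h1 | rfl | h1
  · refine ⟨-1, (hlin x).congr_of_eventuallyEq ?_, ?_⟩
    · filter_upwards [Ioo_mem_nhds hx h1] with y hy using cappedInv_of_mem_Icc ⟨hy.1.le, hy.2.le⟩
    · rw [cappedInv_of_mem_Icc ⟨hx.le, h1.le⟩]
      linarith
  · refine ⟨-1, ?_, by rw [cappedInv_of_one_le le_rfl]; norm_num⟩
    have hl : HasDerivWithinAt cappedInv (-1) (Iic 1) 1 := by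
      refine (hlin 1).hasDerivWithinAt.congr_of_eventuallyEq ?_
        (cappedInv_of_mem_Icc ⟨zero_le_one, le_rfl⟩)
      filter_upwards [self_mem_nhdsWithin, mem_nhdsWithin_of_mem_nhds (Ioi_mem_nhds hx)]
        with y hy hy' using cappedInv_of_mem_Icc ⟨le_of_lt hy', hy⟩
    have hr : HasDerivWithinAt cappedInv (-1) (Ici 1) 1 := by
      have h := (hinv 1 one_pos).hasDerivWithinAt (s := Ici 1)
      rw [one_pow, inv_one] at h
      exact h.congr (fun y hy => cappedInv_of_one_le hy) (cappedInv_of_one_le le_rfl)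
    have := hl.union hr
    rwa [Iic_union_Ici, hasDerivWithinAt_univ] at this
  · refine ⟨-(x ^ 2)⁻¹, (hinv x hx).congr_of_eventuallyEq ?_, ?_⟩
    · filter_upwards [Ioi_mem_nhds h1] with y hy using cappedInv_of_one_le (le_of_lt hy)
    · rw [cappedInv_of_one_le h1.le]
      have : x⁻¹ + x * -(x ^ 2)⁻¹ = 0 := by field_simp; ring
      rw [this]

theorem tendsto_cappedInv_atTop : Tendsto cappedInv atTop (nhds 0) := by
  refine tendsto_inv_atTop_zero.congr' ?_
  filter_upwards [eventually_ge_atTop 1] with x hx using (cappedInv_of_one_le hx).symm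

/-- Every differentiable monotone `r` that is large enough is realised, on `[1, ∞)`, as the slope
of a transformation satisfying the conditions on `(g₁, g₂)`. -/
theorem exists_transformation_eq_mul {r : ℝ → ℝ} {μ σ : ℝ} (hσ : 0 < σ)
    (hr : Differentiable ℝ r) (hrm : Monotone r) (hrge : ∀ y, σ + 2 * max μ 0 ≤ r y) :
    ∃ g₁ g₂ : ℝ → ℝ,
      (Continuous g₁ ∧ Continuous g₂ ∧
        ∀ x : ℝ, x ≠ 0 → DifferentiableAt ℝ g₁ x ∧ DifferentiableAt ℝ g₂ x) ∧
      (Monotone g₁ ∧ Antitone g₂) ∧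
      (Tendsto g₁ atBot (nhds 0) ∧ Tendsto g₂ atTop (nhds 0)) ∧
      (∀ x : ℝ, x ≠ 0 →
        g₁ x + x * deriv g₁ x > -(1/2) ∧ g₂ x + x * deriv g₂ x > -(1/2)) ∧
      (∀ x, 0 ≤ g₁ x ∧ 0 ≤ g₂ x) ∧
      ∀ x, 1 ≤ x → μ + σ * x * (g₁ x + g₂ x + 1) = x * r x := by
  set m := max μ 0 with hm
  set n := max (-μ) 0 with hn
  have hm0 : 0 ≤ m := le_max_right _ _
  have hn0 : 0 ≤ n := le_max_right _ _
  have hmn : m - n = μ := by rw [hm, hn, max_zero_sub_max_neg_zero_eq_self]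
  set b : ℝ → ℝ := fun x => (r x - σ - m * cappedInv x) / σ with hb
  have hb0 : ∀ x, 0 ≤ b x := fun x => div_nonneg
    (by nlinarith [hrge x, cappedInv_le_two x]) hσ.le
  have hbm : Monotone b := by
    intro x y hxy
    have h1 := hrm hxy
    have h2 := mul_le_mul_of_nonneg_left (antitone_cappedInv hxy) hm0
    simp only [hb]
    gcongr
  set g₁ : ℝ → ℝ := fun x => smoothTransition x * b x with hg₁
  set g₂ : ℝ → ℝ := fun x => n / σ * cappedInv x with hg₂
  have hg₁m : Monotone g₁ := fun x y hxy =>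
    mul_le_mul (smoothTransition.monotone hxy) (hbm hxy) (hb0 x) (smoothTransition.nonneg y)
  have hg₁0 : ∀ x, 0 ≤ g₁ x := fun x => mul_nonneg (smoothTransition.nonneg x) (hb0 x)
  have hg₁z : ∀ x, x ≤ 0 → g₁ x = 0 := fun x hx => by
    simp only [hg₁, smoothTransition.zero_of_nonpos hx, zero_mul]
  have hg₂0 : ∀ x, 0 ≤ g₂ x := fun x => mul_nonneg (by positivity) (cappedInv_nonneg x)
  have hcd : ∀ x : ℝ, x ≠ 0 → DifferentiableAt ℝ cappedInv x := fun x hx => by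
    obtain ⟨d, hd, -⟩ := exists_hasDerivAt_cappedInv hx
    exact hd.differentiableAt
  refine ⟨g₁, g₂, ⟨?_, continuous_const.mul continuous_cappedInv, fun x hx => ⟨?_, ?_⟩⟩,
    ⟨hg₁m, fun x y hxy => ?_⟩, ⟨?_, ?_⟩, fun x hx => ⟨?_, ?_⟩, fun x => ⟨hg₁0 x, hg₂0 x⟩,
    fun x hx => ?_⟩
  · exact smoothTransition.continuous.mul
      (((hr.continuous.sub continuous_const).sub
        (continuous_const.mul continuous_cappedInv)).div_const σ)
  · exact ((smoothTransition.contDiff (n := 1)).differentiable one_ne_zero x).mul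
      (((hr x).sub_const σ).sub ((hcd x hx).const_mul m) |>.div_const σ)
  · exact (hcd x hx).const_mul _
  · exact mul_le_mul_of_nonneg_left (antitone_cappedInv hxy) (by positivity)
  · refine tendsto_const_nhds.congr' ?_
    filter_upwards [eventually_le_atBot 0] with x hx using (hg₁z x hx).symm
  · simpa using tendsto_cappedInv_atTop.const_mul (n / σ)
  · rcases hx.lt_or_gt with hx | hx
    · have hev : g₁ =ᶠ[nhds x] fun _ => 0 := by
        filter_upwards [Iio_mem_nhds hx] with y hy using hg₁z y (le_of_lt hy)
      rw [hev.deriv_eq, hg₁z x hx.le]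
      norm_num
    · have := mul_nonneg hx.le (hg₁m.deriv_nonneg (x := x))
      linarith [hg₁0 x]
  · obtain ⟨d, hd, hd0⟩ := exists_hasDerivAt_cappedInv hx
    have hderiv : deriv g₂ x = n / σ * d := (hd.const_mul (n / σ)).deriv
    have : g₂ x + x * deriv g₂ x = n / σ * (cappedInv x + x * d) := by
      rw [hderiv]
      simp only [hg₂]
      ring
    rw [this]
    have : 0 ≤ n / σ * (cappedInv x + x * d) := mul_nonneg (by positivity) hd0
    linarith
  · have hx0 : x ≠ 0 := by linarith
    simp only [hg₁, hg₂, hb, smoothTransition.one_of_one_le hx, cappedInv_of_one_le hx]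
    rw [← hmn]
    field_simp
    ring

/-- A continuous function tending to infinity at infinity and bounded above on left half-lines
has, near infinity, a right inverse `Function.invFun` which tends to infinity. -/
theorem Continuous.tendsto_invFun_atTop {f : ℝ → ℝ} (hf : Continuous f)
    (htop : Tendsto f atTop atTop) (hbdd : ∀ M, ∃ B, ∀ y ≤ M, f y ≤ B) :
    (∀ᶠ x in atTop, f (Function.invFun f x) = x) ∧
      Tendsto (Function.invFun f) atTop atTop := by
  have hev : ∀ᶠ x in atTop, f (Function.invFun f x) = x := by
    filter_upwards [eventually_ge_atTop (f 0)] with x hx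
    refine Function.invFun_eq ?_
    obtain ⟨z, hz⟩ := (htop.eventually_ge_atTop x).exists
    obtain ⟨y, hy⟩ := mem_range_of_exists_le_of_exists_ge hf ⟨0, hx⟩ ⟨z, hz⟩
    exact ⟨y, hy⟩
  refine ⟨hev, tendsto_atTop.2 fun M => ?_⟩
  obtain ⟨B, hB⟩ := hbdd M
  filter_upwards [hev, eventually_gt_atTop B] with x hx hxB
  by_contra h
  have := hB _ (not_le.1 h).le
  linarith

/-- Proposition 6: if `F₂` has a heavier right tail than `F₁`, admits a density `p₂`
that is decreasing for large `x`, and the quantile ratio `F₂⁻¹(α)/F₁⁻¹(α)` is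
non-decreasing near `α = 1`, then for any `μ` and `σ > 0` one can choose `g₁, g₂`
satisfying (C1)–(C4) so that the distribution `F₁ ∘ f⁻¹` determined by the quantile
function `f(F₁⁻¹(α))` has exactly the same right-tail heaviness as `F₂`, in the sense
that `(1 − F₂(x))/(1 − F₁(f⁻¹(x))) → 1`. -/
theorem exists_transformation_matching_tail
    (F₁ F₂ : ℝ → ℝ) (hF₁cont : Continuous F₁) (hF₂cont : Continuous F₂)
    (hF₁mono : StrictMono F₁) (hF₂mono : StrictMono F₂)
    (hF₁range : ∀ x : ℝ, F₁ x ∈ Set.Ioo (0 : ℝ) 1)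
    (hF₂range : ∀ x : ℝ, F₂ x ∈ Set.Ioo (0 : ℝ) 1)
    (hheavier : ∀ μ σ : ℝ, 0 < σ →
      Tendsto (fun x : ℝ => (1 - F₂ x) / (1 - F₁ ((x - μ) / σ))) atTop atTop)
    (p₂ : ℝ → ℝ) (hp₂ : ∀ x : ℝ, HasDerivAt F₂ (p₂ x) x)
    (hp₂dec : ∃ X₀ : ℝ, AntitoneOn p₂ (Set.Ici X₀))
    (Finv₁ Finv₂ : ℝ → ℝ)
    (hFinv₁ : ∀ α ∈ Set.Ioo (0 : ℝ) 1, F₁ (Finv₁ α) = α)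
    (hFinv₂ : ∀ α ∈ Set.Ioo (0 : ℝ) 1, F₂ (Finv₂ α) = α)
    (hratio : ∃ α₀ ∈ Set.Ioo (0 : ℝ) 1,
      MonotoneOn (fun α : ℝ => Finv₂ α / Finv₁ α) (Set.Ioo α₀ 1)) :
    ∀ μ σ : ℝ, 0 < σ → ∃ g₁ g₂ : ℝ → ℝ,
      (Continuous g₁ ∧ Continuous g₂ ∧
        ∀ x : ℝ, x ≠ 0 → DifferentiableAt ℝ g₁ x ∧ DifferentiableAt ℝ g₂ x) ∧
      (Monotone g₁ ∧ Antitone g₂) ∧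
      (Tendsto g₁ atBot (nhds 0) ∧ Tendsto g₂ atTop (nhds 0)) ∧
      (∀ x : ℝ, x ≠ 0 →
        g₁ x + x * deriv g₁ x > -(1/2) ∧ g₂ x + x * deriv g₂ x > -(1/2)) ∧
      Tendsto (fun x : ℝ =>
          (1 - F₂ x) /
          (1 - F₁ (Function.invFun (fun y : ℝ => μ + σ * y * (g₁ y + g₂ y + 1)) x)))
        atTop (nhds 1) := by
  intro μ σ hσ
  -- The quantile transport `Q` satisfies `F₂ (Q y) = F₁ y`.
  set Q : ℝ → ℝ := fun y => Finv₂ (F₁ y)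
  have hQF : ∀ y, F₂ (Q y) = F₁ y := fun y => hFinv₂ _ (hF₁range y)
  have hinv₁ : ∀ y, Finv₁ (F₁ y) = y := fun y => hF₁mono.injective (hFinv₁ _ (hF₁range y))
  have hQmono : Monotone Q := fun x y hxy => by
    rw [← hF₂mono.le_iff_le, hQF, hQF]
    exact hF₁mono.monotone hxy
  have hQsurj : Function.Surjective Q := fun z => by
    refine ⟨Finv₁ (F₂ z), hF₂mono.injective ?_⟩
    rw [hQF, hFinv₁ _ (hF₂range z)]
  have hQcont : Continuous Q := hQmono.continuous_of_surjective hQsurj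
  set K := σ + 2 * max μ 0
  have hK0 : 0 < K := by
    have : 0 ≤ max μ 0 := le_max_right _ _
    linarith
  -- The heavier tail of `F₂` makes `Q` eventually dominate every linear function.
  have hQlin : ∀ᶠ y in atTop, K * y ≤ Q y := by
    have h := (tendsto_id.const_mul_atTop hK0).eventually
      ((hheavier 0 K hK0).eventually_ge_atTop 1)
    filter_upwards [h] with y hy
    simp only [id, sub_zero, mul_div_cancel_left₀ y hK0.ne'] at hy
    rw [one_le_div (sub_pos.2 (hF₁range y).2)] at hy
    rw [← hF₂mono.le_iff_le, hQF]
    linarith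
  obtain ⟨α₀, hα₀, hmono⟩ := hratio
  obtain ⟨Y, hYlin, hY1, hYα⟩ := (hQlin.and ((eventually_ge_atTop (1 : ℝ)).and
    (eventually_gt_atTop (Finv₁ α₀)))).exists
  have hFα : ∀ y, Y ≤ y → F₁ y ∈ Ioo α₀ 1 := fun y hy => by
    refine ⟨?_, (hF₁range y).2⟩
    rw [← hFinv₁ α₀ hα₀]
    exact hF₁mono (hYα.trans_le hy)
  have hratioQ : ∀ y z, Y ≤ y → y ≤ z → Q y / y ≤ Q z / z := fun y z hy hyz => by
    have := hmono (hFα y hy) (hFα z (hy.trans hyz)) (hF₁mono.monotone hyz)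
    simpa only [hinv₁] using this
  set q : ℝ → ℝ := fun y => Q (max y Y) / max y Y with hq
  have hqm : Monotone q := fun y z hyz =>
    hratioQ _ _ (le_max_right _ _) (max_le_max_right Y hyz)
  have hqc : Continuous q := by
    refine Continuous.div (hQcont.comp (by fun_prop)) (by fun_prop) fun y => ?_
    have := le_max_right y Y
    linarith
  have hqK : ∀ y, K ≤ q y := fun y => by
    refine le_trans ?_ (hratioQ Y (max y Y) le_rfl (le_max_right _ _))
    rw [le_div_iff₀ (by linarith)]
    exact hYlin
  have hqY : ∀ y, Y ≤ y → q y = Q y / y := fun y hy => by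
    simp only [hq, max_eq_left hy]
  obtain ⟨u, hua, hu0, hu1, hu⟩ :=
    exists_antitone_tail_modulus hF₁cont hF₁mono fun x => (hF₁range x).2
  obtain ⟨δ, hδd, hδ0, hδu, hδm⟩ := hua.exists_differentiable_pos_le hu0 hu1
  obtain ⟨r, hrd, hrm, hrq⟩ := hqm.exists_differentiable_between hqc hδd hδ0 hδm
  have hrK : ∀ y, K ≤ r y := fun y => (hqK y).trans (hrq y).1
  obtain ⟨g₁, g₂, hC1, hC2, hC3, hC4, hg0, hfr⟩ :=
    exists_transformation_eq_mul hσ hrd hrm hrK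
  refine ⟨g₁, g₂, hC1, hC2, hC3, hC4, ?_⟩
  set f : ℝ → ℝ := fun y => μ + σ * y * (g₁ y + g₂ y + 1) with hf
  have hfc : Continuous f := by
    have h1 := hC1.1
    have h2 := hC1.2.1
    fun_prop
  have hftop : Tendsto f atTop atTop := by
    refine tendsto_atTop_mono' _ ?_ (tendsto_id.const_mul_atTop hK0)
    filter_upwards [eventually_ge_atTop 1] with y hy
    simp only [hf, hfr y hy, id]
    rw [mul_comm]
    exact mul_le_mul_of_nonneg_left (hrK y) (by linarith)
  have hfb : ∀ M, ∃ B, ∀ y ≤ M, f y ≤ B := fun M => by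
    refine ⟨μ + σ * max M 0 * (g₁ (max M 0) + g₂ 0 + 1), fun y hy => ?_⟩
    have hM0 : 0 ≤ max M 0 := le_max_right _ _
    have hs : 0 ≤ g₁ y + g₂ y + 1 := by linarith [(hg0 y).1, (hg0 y).2]
    have hS : 0 ≤ g₁ (max M 0) + g₂ 0 + 1 := by linarith [(hg0 (max M 0)).1, (hg0 0).2]
    rcases le_total y 0 with h0 | h0
    · have h1 : σ * y * (g₁ y + g₂ y + 1) ≤ 0 :=
        mul_nonpos_of_nonpos_of_nonneg (mul_nonpos_of_nonneg_of_nonpos hσ.le h0) hs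
      have h2 : 0 ≤ σ * max M 0 * (g₁ (max M 0) + g₂ 0 + 1) := by positivity
      simp only [hf]
      linarith
    · have hyM : y ≤ max M 0 := hy.trans (le_max_left _ _)
      have h1 : g₁ y ≤ g₁ (max M 0) := hC2.1 hyM
      have h2 : g₂ y ≤ g₂ 0 := hC2.2 h0
      simp only [hf]
      gcongr
  obtain ⟨hfinv, hinvtop⟩ := hfc.tendsto_invFun_atTop hftop hfb
  have hkey : Tendsto (fun y => (1 - F₂ (f y)) / (1 - F₁ y)) atTop (nhds 1) := by
    have hlow : Tendsto (fun y : ℝ => 1 - exp (-y)) atTop (nhds 1) := by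
      simpa using tendsto_exp_neg_atTop_nhds_zero.const_sub 1
    refine tendsto_of_tendsto_of_tendsto_of_le_of_le' hlow tendsto_const_nhds ?_ ?_
    · filter_upwards [eventually_ge_atTop Y] with y hy
      have hy1 : 1 ≤ y := hY1.trans hy
      have hyδ : y ≤ y + δ y := by linarith [hδ0 y]
      rw [le_div_iff₀ (sub_pos.2 (hF₁range y).2)]
      have hr2 := (hrq y).2
      rw [hqY _ (hy.trans hyδ)] at hr2
      have hfle : f y ≤ Q (y + δ y) := by
        have hqpos : 0 < Q (y + δ y) / (y + δ y) := hK0.trans_le ((hrK y).trans hr2)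
        calc f y = y * r y := hfr y hy1
          _ ≤ (y + δ y) * (Q (y + δ y) / (y + δ y)) := by
            refine mul_le_mul hyδ hr2 (hK0.le.trans (hrK y)) (by linarith)
          _ = Q (y + δ y) := mul_div_cancel₀ _ (by linarith)
      have h1 := hF₂mono.monotone hfle
      rw [hQF] at h1
      have h2 := hF₁mono.monotone (show y + δ y ≤ y + u y by linarith [hδu y])
      have h3 := hu y (by linarith)
      linarith
    · filter_upwards [eventually_ge_atTop Y] with y hy
      have hy1 : 1 ≤ y := hY1.trans hy
      rw [div_le_one (sub_pos.2 (hF₁range y).2)]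
      have hr1 := (hrq y).1
      rw [hqY _ hy, div_le_iff₀ (by linarith)] at hr1
      have hfge : Q y ≤ f y := by
        rw [show f y = y * r y from hfr y hy1]
        linarith
      have h1 := hF₂mono.monotone hfge
      rw [hQF] at h1
      linarith
  refine (hkey.comp hinvtop).congr' ?_
  filter_upwards [hfinv] with x hx
  simp only [Function.comp, hx]
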